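/- Let f : (Fin d → ℝ) → (Fin d → ℝ) be a vector field, let ι be a finite index type, and for each i ∈ ι let φᵢ : (Fin d → ℝ) → ℂ be a differentiable generator eigenfunction of f at eigenvalue λᵢ ∈ ℂ, i.e. fderiv ℝ φᵢ x (f x) = λᵢ * φᵢ x for all x. Then for every m : ι → ℕ, the function Φ : x ↦ ∏ i, (φᵢ x) ^ (m i) is differentiable and is a generator eigenfunction of f at eigenvalue ∑ i, (m i : ℂ) * λᵢ, i.e. fderiv ℝ Φ x (f x) = (∑ i, (m i : ℂ) * λᵢ) * Φ x for every x. -/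

import Mathlib

/-- Generator eigenfunctions multiply, and their eigenvalues add. -/
theorem gen_eig_mul {d : ℕ} (f : (Fin d → ℝ) → (Fin d → ℝ)) (a b : (Fin d → ℝ) → ℂ) (p q : ℂ)
    (ha : Differentiable ℝ a ∧ ∀ x, fderiv ℝ a x (f x) = p * a x)
    (hb : Differentiable ℝ b ∧ ∀ x, fderiv ℝ b x (f x) = q * b x) :
    Differentiable ℝ (fun x => a x * b x) ∧
      ∀ x, fderiv ℝ (fun x => a x * b x) x (f x) = (p + q) * (a x * b x) := by
  refine ⟨ha.1.mul hb.1, fun x => ?_⟩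
  have h : HasFDerivAt (fun x => a x * b x) _ x := (ha.1 x).hasFDerivAt.mul (hb.1 x).hasFDerivAt
  rw [h.fderiv]
  simp only [ContinuousLinearMap.add_apply, ContinuousLinearMap.smul_apply, smul_eq_mul,
    ha.2 x, hb.2 x]
  ring

theorem gen_eig_pow {d : ℕ} (f : (Fin d → ℝ) → (Fin d → ℝ)) (a : (Fin d → ℝ) → ℂ) (p : ℂ)
    (ha : Differentiable ℝ a ∧ ∀ x, fderiv ℝ a x (f x) = p * a x) (n : ℕ) :
    Differentiable ℝ (fun x => a x ^ n) ∧
      ∀ x, fderiv ℝ (fun x => a x ^ n) x (f x) = ((n : ℂ) * p) * a x ^ n := by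
  induction n with
  | zero => simp
  | succ k ih =>
    have := gen_eig_mul f _ _ _ _ ih ha
    simpa only [pow_succ, Nat.cast_succ, add_mul, one_mul] using this

theorem product_powers_of_generator_eigenfunctions
    {d : ℕ} (f : (Fin d → ℝ) → (Fin d → ℝ))
    {ι : Type*} [Fintype ι]
    (φ : ι → (Fin d → ℝ) → ℂ) (lam : ι → ℂ)
    (hdiff : ∀ i, Differentiable ℝ (φ i))
    (heig : ∀ i, ∀ x, fderiv ℝ (φ i) x (f x) = lam i * φ i x)
    (m : ι → ℕ) :
    Differentiable ℝ (fun x => ∏ i, (φ i x) ^ (m i)) ∧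
      ∀ x, fderiv ℝ (fun x => ∏ i, (φ i x) ^ (m i)) x (f x)
        = (∑ i, (m i : ℂ) * lam i) * ∏ i, (φ i x) ^ (m i) := by
  classical
  induction (Finset.univ : Finset ι) using Finset.induction_on with
  | empty => simp
  | insert j s hj ih =>
    simp only [Finset.prod_insert hj, Finset.sum_insert hj]
    exact gen_eig_mul f _ _ _ _ (gen_eig_pow f _ _ ⟨hdiff j, heig j⟩ (m j)) ih
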